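/- Let p > 3 be a prime, q a power of p, and let i, ℓ, m ≥ 0 be integers. For n = 3·p^m and d = (p^i + 1)·p^ℓ, one has 𝒟_{n,d} = (p − 3)·x^{d·p^m} in 𝔽_q[x] (where p − 3 denotes the reduction of the integer −3 into 𝔽_q); in particular 𝒟_{n,d} is a Dembowski–Ostrom polynomial. -/

import Mathlib

open Polynomial Finset

/-- A Dembowski–Ostrom polynomial in characteristic `p`: every exponent occurring with a
nonzero coefficient is of the form `p^i + p^j` for nonnegative integers `i, j`. -/
def IsDOPoly (p : ℕ) {F : Type*} [Field F] (f : F[X]) : Prop :=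
  ∀ k ∈ f.support, ∃ i j : ℕ, k = p ^ i + p ^ j

/-- The integer coefficient `(n/(n-i)) * binom(n-i, i)` of the reversed Dickson
polynomial of the first kind (the natural division is exact). -/
def dicksonCoeff (n i : ℕ) : ℕ := n * (n - i).choose i / (n - i)

/-- `𝒟_{n,d} = D_n(1, x^d) - D_n(1, 0)` over `F`, i.e.
`∑_{i=1}^{⌊n/2⌋} (n/(n-i))·binom(n-i,i)·(-1)^i·x^{d·i}`. -/
noncomputable def DD (F : Type*) [Field F] (n d : ℕ) : F[X] :=
  ∑ i ∈ Finset.Icc 1 (n / 2), C ((-1 : F) ^ i * (dicksonCoeff n i : F)) * X ^ (d * i)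

/-- `𝖤_{n,d} = E_n(1, x^d) - E_n(1, 0)` over `F`, i.e.
`∑_{i=1}^{⌊n/2⌋} binom(n-i,i)·(-1)^i·x^{d·i}`. -/
noncomputable def EE (F : Type*) [Field F] (n d : ℕ) : F[X] :=
  ∑ i ∈ Finset.Icc 1 (n / 2), C ((-1 : F) ^ i * ((n - i).choose i : F)) * X ^ (d * i)

/-- The reversed Dickson polynomial of the first kind `D_n(a, x)`, as a function on `F`. -/
def revDicksonFst {F : Type*} [Field F] (n : ℕ) (a x : F) : F :=
  ∑ i ∈ Finset.range (n / 2 + 1), (dicksonCoeff n i : F) * (-x) ^ i * a ^ (n - 2 * i)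

/-- The reversed Dickson polynomial of the second kind `E_n(a, x)`, as a function on `F`. -/
def revDicksonSnd {F : Type*} [Field F] (n : ℕ) (a x : F) : F :=
  ∑ i ∈ Finset.range (n / 2 + 1), ((n - i).choose i : F) * (-x) ^ i * a ^ (n - 2 * i)

/-- `D_n(1, x)` as a one-variable polynomial over `F`. -/
noncomputable def revDicksonFstPoly (F : Type*) [Field F] (n : ℕ) : F[X] :=
  ∑ i ∈ Finset.range (n / 2 + 1), C ((-1 : F) ^ i * (dicksonCoeff n i : F)) * X ^ i

/-- The division in the definition of `dicksonCoeff` yields a sum of two binomials. -/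
theorem dicksonCoeff_add_succ (a k : ℕ) :
    dicksonCoeff (a + 1 + (k + 1)) (k + 1) = (a + 1).choose (k + 1) + a.choose k := by
  have h := Nat.add_one_mul_choose_eq a k
  rw [dicksonCoeff, Nat.add_sub_cancel]
  refine Nat.div_eq_of_eq_mul_right (Nat.succ_pos a) ?_
  linear_combination -h

theorem add_succ_mul_dicksonCoeff (a k : ℕ) :
    (a + 1) * dicksonCoeff (a + 1 + (k + 1)) (k + 1) =
      (a + 1 + (k + 1)) * (a + 1).choose (k + 1) := by
  rw [dicksonCoeff_add_succ]
  linear_combination Nat.add_one_mul_choose_eq a k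

theorem succ_mul_dicksonCoeff (a k : ℕ) :
    (k + 1) * dicksonCoeff (a + 1 + (k + 1)) (k + 1) = (a + 1 + (k + 1)) * a.choose k := by
  rw [dicksonCoeff_add_succ]
  linear_combination -Nat.add_one_mul_choose_eq a k

theorem choose_two_mul_prime_pow_modEq {p : ℕ} (hp : p.Prime) (m : ℕ) :
    (2 * p ^ m).choose (p ^ m) ≡ 2 [MOD p] := by
  have := Fact.mk hp
  induction m with
  | zero => rfl
  | succ m ih =>
    have h := Choose.choose_modEq_choose_mod_mul_choose_div_nat
      (n := 2 * p ^ (m + 1)) (k := p ^ (m + 1)) (p := p)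
    rw [pow_succ, ← mul_assoc, Nat.mul_mod_left, Nat.mul_mod_left,
      Nat.mul_div_cancel _ hp.pos, Nat.mul_div_cancel _ hp.pos, Nat.choose_self, one_mul] at h
    rw [pow_succ, ← mul_assoc]
    exact h.trans ih

/-- For `0 < j ≤ 3 p ^ m / 2`, only the coefficient at `j = p ^ m` can survive modulo `p`. -/
theorem dvd_dicksonCoeff_three_mul_pow {p : ℕ} (hp : p.Prime) {m j : ℕ} (hj : 1 ≤ j)
    (hj' : j ≤ 3 * p ^ m / 2) (hne : j ≠ p ^ m) : p ∣ dicksonCoeff (3 * p ^ m) j := by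
  have hpos : 0 < p ^ m := pow_pos hp.pos m
  by_contra hdvd
  obtain ⟨k, rfl⟩ := Nat.exists_eq_add_of_le' hj
  obtain ⟨a, ha⟩ : ∃ a, 3 * p ^ m = a + 1 + (k + 1) := ⟨3 * p ^ m - (k + 1) - 1, by omega⟩
  have h := succ_mul_dicksonCoeff a k
  rw [← ha, mul_comm 3 (p ^ m), mul_assoc] at h
  rw [mul_comm 3 (p ^ m)] at hdvd
  have hpow : p ^ m ∣ k + 1 :=
    ((hp.coprime_iff_not_dvd.2 hdvd).pow_left m).dvd_of_dvd_mul_right ⟨_, h⟩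
  obtain ⟨c, hc⟩ := hpow
  have hc2 : c < 2 := by
    by_contra! hc2
    have := Nat.mul_le_mul_left (p ^ m) hc2
    omega
  interval_cases c <;> omega

theorem dicksonCoeff_three_mul_pow_modEq {p : ℕ} (hp : p.Prime) (hp2 : p ≠ 2) (m : ℕ) :
    dicksonCoeff (3 * p ^ m) (p ^ m) ≡ 3 [MOD p] := by
  have hpos : 0 < p ^ m := pow_pos hp.pos m
  have h2 : 2 * dicksonCoeff (3 * p ^ m) (p ^ m) = 3 * (2 * p ^ m).choose (p ^ m) := by
    have h := add_succ_mul_dicksonCoeff (2 * p ^ m - 1) (p ^ m - 1)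
    rw [Nat.sub_add_cancel (by omega), Nat.sub_add_cancel (by omega),
      show 2 * p ^ m + p ^ m = 3 * p ^ m by ring] at h
    refine Nat.eq_of_mul_eq_mul_left hpos ?_
    linear_combination h
  refine Nat.ModEq.cancel_left_of_coprime (c := 2)
    ((Nat.coprime_primes hp Nat.prime_two).2 hp2) ?_
  rw [h2]
  exact (choose_two_mul_prime_pow_modEq hp m).mul_left 3

theorem DD_three_mul_pow {F : Type*} [Field F] {p : ℕ} [CharP F p] (hp : p.Prime)
    (hp2 : p ≠ 2) (m d : ℕ) :
    DD F (3 * p ^ m) d = C ((-3 : ℤ) : F) * X ^ (d * p ^ m) := by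
  have hpos : 0 < p ^ m := pow_pos hp.pos m
  rw [DD, Finset.sum_eq_single_of_mem (p ^ m) (Finset.mem_Icc.2 ⟨hpos, by omega⟩)]
  · have h : (dicksonCoeff (3 * p ^ m) (p ^ m) : F) = (3 : ℕ) :=
      (CharP.natCast_eq_natCast F p).2 (dicksonCoeff_three_mul_pow_modEq hp hp2 m)
    rw [h, ((hp.odd_of_ne_two hp2).pow).neg_one_pow]
    norm_num
  · intro j hj hne
    obtain ⟨hj1, hj2⟩ := Finset.mem_Icc.1 hj
    rw [(CharP.cast_eq_zero_iff F p _).2 (dvd_dicksonCoeff_three_mul_pow hp hj1 hj2 hne)]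
    simp

theorem stmt12 {F : Type*} [Field F] [Fintype F] (p e : ℕ) (hp : p.Prime)
    (hp3 : 3 < p) (he : 0 < e) (hcard : Fintype.card F = p ^ e) (i l m : ℕ) :
    DD F (3 * p ^ m) ((p ^ i + 1) * p ^ l) =
        C ((-3 : ℤ) : F) * X ^ ((p ^ i + 1) * p ^ l * p ^ m) ∧
      IsDOPoly p (DD F (3 * p ^ m) ((p ^ i + 1) * p ^ l)) := by
  have := Fact.mk hp
  have : CharP F p := charP_of_card_eq_prime_pow hcard
  have h := DD_three_mul_pow (F := F) hp (by omega) m ((p ^ i + 1) * p ^ l)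
  refine ⟨h, fun k hk => ⟨i + l + m, l + m, ?_⟩⟩
  rw [h] at hk
  rw [Finset.mem_singleton.1 (support_C_mul_X_pow_subset _ _ hk)]
  ring
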